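/- Let P be an n-dimensional convex polytope admitting a conic sequence whose corresponding sequence 𝒞 = {C_2, …, C_ℓ} consists of cubes. Then Σ_{k=0}^n f_k(P) x^k = 1 + Σ_{k=1}^{n} h_k^□ (1 + x(x+2)^{k−1}), where h_k^□ is the number of (k−1)-dimensional cubes among C_2, …, C_ℓ, and h_k^□ ≥ 1 for all 1 ≤ k ≤ n. -/

import Mathlib

open Set Polynomial Metric

/-! ### Polytopes, faces, and conic sequences -/

variable {V : Type*} [NormedAddCommGroup V] [NormedSpace ℝ V]

/-- A (convex) polytope: the convex hull of a finite set. -/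
def IsPolytope (P : Set V) : Prop := ∃ S : Finset V, P = convexHull ℝ (S : Set V)

/-- `F` is a face of the polytope `P` (exposed face; this includes `∅` and `P` itself). -/
def IsFaceOf (F P : Set V) : Prop := IsExposed ℝ P F

/-- The set of all faces of a polytope, i.e. the polytopal complex of all faces of `P`. -/
def faces (P : Set V) : Set (Set V) := {F | IsFaceOf F P}

/-- The dimension of a polytope (the affine dimension of the set). -/
noncomputable def polyDim (s : Set V) : ℕ := Module.finrank ℝ (vectorSpan ℝ s)

/-- The number `f_k(Q)` of `k`-dimensional (nonempty) faces of a polytope `Q`. -/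
noncomputable def faceCount (Q : Set V) (k : ℕ) : ℕ :=
  Nat.card {F : Set V // IsFaceOf F Q ∧ F.Nonempty ∧ polyDim F = k}

/-- The generating function `Φ_Q(x) = ∑_{k=0}^{dim Q} f_k(Q) x^k` of the face numbers. -/
noncomputable def faceGen (Q : Set V) : Polynomial ℚ :=
  ∑ k ∈ Finset.range (polyDim Q + 1), Polynomial.C ((faceCount Q k : ℚ)) * Polynomial.X ^ k

/-- The dimension of a collection of polytopes: the largest dimension of a member. -/
noncomputable def cpxDim (S : Set (Set V)) : ℕ := sSup (polyDim '' S)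

/-- A conic sequence `𝒫 = 𝒫_ℓ, 𝒫_{ℓ-1}, …, 𝒫_1` of a polytopal complex with cell set `K`:
at each step `2 ≤ i ≤ ℓ`, one removes the interval `[v_i, E_i]`, where `v_i` is a cone
vertex of `𝒫_i`, i.e. a vertex such that the subposet `{F ∈ 𝒫_i : v_i ∈ F}` has a unique
maximal (equivalently, greatest) element `E_i`; the sequence ends with `𝒫_1 = {∅, {v_1}}`. -/
structure ConicSeq (K : Set (Set V)) (ℓ : ℕ) where
  cpx : ℕ → Set (Set V)
  v : ℕ → V
  E : ℕ → Set V
  one_le : 1 ≤ ℓ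
  top : cpx ℓ = K
  bottom : cpx 1 = {∅, {v 1}}
  vtx_mem : ∀ i, 2 ≤ i → i ≤ ℓ → {v i} ∈ cpx i
  E_mem : ∀ i, 2 ≤ i → i ≤ ℓ → E i ∈ cpx i
  v_mem_E : ∀ i, 2 ≤ i → i ≤ ℓ → v i ∈ E i
  E_greatest : ∀ i, 2 ≤ i → i ≤ ℓ → ∀ F ∈ cpx i, v i ∈ F → F ⊆ E i
  step : ∀ i, 2 ≤ i → i ≤ ℓ → cpx (i - 1) = cpx i \ {F | F ∈ cpx i ∧ v i ∈ F ∧ F ⊆ E i}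

/-- The interval `[v_i, E_i]` removed at step `i` of a conic sequence. -/
def ConicSeq.interval {K : Set (Set V)} {ℓ : ℕ} (cs : ConicSeq K ℓ) (i : ℕ) : Set (Set V) :=
  {F | F ∈ cs.cpx i ∧ cs.v i ∈ F ∧ F ⊆ cs.E i}

/-- `C` is the intersection of the face `E` with an affine hyperplane separating the cone
vertex `vtx` from `Pprev ∩ E`, where `Pprev` is the geometric realization `P_{i-1}`. -/
def IsConeSlice (C : Set V) (E : Set V) (vtx : V) (Pprev : Set V) : Prop :=
  ∃ (f : V →L[ℝ] ℝ) (c : ℝ), c < f vtx ∧ (∀ x ∈ Pprev ∩ E, f x < c) ∧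
    C = {x ∈ E | f x = c}

/-- `C i` is the cone-slice polytope `C_i` of the conic sequence `cs`, for `2 ≤ i ≤ ℓ`. -/
def ConicSeq.HasSlices {K : Set (Set V)} {ℓ : ℕ} (cs : ConicSeq K ℓ) (C : ℕ → Set V) : Prop :=
  ∀ i, 2 ≤ i → i ≤ ℓ → IsConeSlice (C i) (cs.E i) (cs.v i) (⋃₀ cs.cpx (i - 1))

/-- A simplex: the convex hull of a nonempty affinely independent finite set. -/
def IsSimplex (C : Set V) : Prop :=
  ∃ S : Finset V, S.Nonempty ∧ AffineIndependent ℝ (fun x : {x // x ∈ S} => (x : V)) ∧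
    C = convexHull ℝ (S : Set V)

/-- A polytope combinatorially equivalent to the `d`-dimensional cube `I^d = [0,1]^d`,
i.e. whose face poset is isomorphic to that of `[0,1]^d`. -/
def IsCombCube (C : Set V) (d : ℕ) : Prop :=
  Nonempty ({F : Set V // IsFaceOf F C} ≃o
    {F : Set (Fin d → ℝ) // IsFaceOf F (Set.Icc (0 : Fin d → ℝ) 1)})

/-- A nondegenerate segment (a copy of the interval `I`). -/
def IsSegment (C : Set V) : Prop := ∃ a b : V, a ≠ b ∧ C = segment ℝ a b

/-- A facet: a nonempty face of codimension one. -/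
def IsFacetOf (F P : Set V) : Prop := IsFaceOf F P ∧ F.Nonempty ∧ polyDim F + 1 = polyDim P

/-- A simple polytope: each vertex lies on exactly `dim`-many facets. -/
def IsSimplePolytope (P : Set V) : Prop :=
  IsPolytope P ∧ P.Nonempty ∧
    ∀ w : V, IsFaceOf {w} P → Nat.card {F : Set V // IsFacetOf F P ∧ w ∈ F} = polyDim P

/-! ### Faces of polytopes -/

theorem IsPolytope.convex {P : Set V} (hP : IsPolytope P) : Convex ℝ P := by
  obtain ⟨S, rfl⟩ := hP
  exact convex_convexHull ℝ _

theorem IsPolytope.finiteDimensional {P : Set V} (hP : IsPolytope P) :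
    FiniteDimensional ℝ (vectorSpan ℝ P) := by
  obtain ⟨S, rfl⟩ := hP
  rw [← direction_affineSpan, affineSpan_convexHull, direction_affineSpan]
  exact finiteDimensional_vectorSpan_of_finite ℝ S.finite_toSet

theorem IsFaceOf.exists_support {F P : Set V} (h : IsFaceOf F P) (hF : F.Nonempty) :
    ∃ (l : V →L[ℝ] ℝ) (b : ℝ), (∀ x ∈ P, l x ≤ b) ∧ F = {x ∈ P | l x = b} := by
  obtain ⟨l, hl⟩ := h hF
  obtain ⟨z, hz⟩ := hF
  have hz' := hz
  rw [hl] at hz'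
  refine ⟨l, l z, hz'.2, ?_⟩
  rw [hl]
  ext x
  constructor
  · rintro ⟨hx, h⟩
    exact ⟨hx, le_antisymm (hz'.2 x hx) (h z hz'.1)⟩
  · rintro ⟨hx, h⟩
    exact ⟨hx, fun y hy => h ▸ hz'.2 y hy⟩

theorem isFaceOf_of_support {P : Set V} (l : V →L[ℝ] ℝ) (b : ℝ) (h : ∀ x ∈ P, l x ≤ b) :
    IsFaceOf {x ∈ P | l x = b} P := by
  rintro ⟨z, hz, hzb⟩
  refine ⟨l, ?_⟩
  ext x
  constructor
  · rintro ⟨hx, e⟩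
    exact ⟨hx, fun y hy => e ▸ h y hy⟩
  · rintro ⟨hx, e⟩
    exact ⟨hx, le_antisymm (h x hx) (hzb ▸ e z hz)⟩

theorem le_on_convexHull {s : Set V} {l : V →L[ℝ] ℝ} {b : ℝ} (h : ∀ x ∈ s, l x ≤ b) :
    ∀ x ∈ convexHull ℝ s, l x ≤ b :=
  fun _ hx => convexHull_min (t := {x | l x ≤ b}) h (convex_halfSpace_le l.isLinear b) hx

theorem support_subset_convexHull {s : Set V} {l : V →L[ℝ] ℝ} {b : ℝ} (h : ∀ x ∈ s, l x ≤ b)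
    {x : V} (hx : x ∈ convexHull ℝ s) (hxb : l x = b) :
    x ∈ convexHull ℝ {y ∈ s | l y = b} := by
  set T := convexHull ℝ {y ∈ s | l y = b} with hT
  have hTb : ∀ y ∈ T, l y = b := fun y hy =>
    convexHull_min (t := {x | l x = b}) (fun z hz => hz.2) (convex_hyperplane l.isLinear b) hy
  have hK : Convex ℝ ({y | l y < b} ∪ T) := by
    rw [convex_iff_forall_pos]
    intro y hy z hz α β hα hβ hαβ
    have key : ∀ u ∈ ({y | l y < b} ∪ T), l u ≤ b := by
      rintro u (hu | hu)
      · exact le_of_lt hu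
      · exact (hTb u hu).le
    by_cases hb : l y < b ∨ l z < b
    · left
      have h1 := key y hy
      have h2 := key z hz
      simp only [mem_ofPred_eq, map_add, map_smul, smul_eq_mul]
      have : b = α * b + β * b := by rw [← add_mul, hαβ, one_mul]
      rcases hb with hb | hb <;> nlinarith
    · push Not at hb
      right
      exact convex_convexHull ℝ _ (hy.resolve_left (not_lt.2 hb.1))
        (hz.resolve_left (not_lt.2 hb.2)) hα.le hβ.le hαβ
  have : x ∈ {y | l y < b} ∪ T := by
    refine convexHull_min ?_ hK hx
    intro y hy
    rcases (h y hy).lt_or_eq with h1 | h1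
    · exact Or.inl h1
    · exact Or.inr (subset_convexHull ℝ _ ⟨hy, h1⟩)
  exact this.resolve_left (by simp [hxb])

theorem IsFaceOf.subset {F P : Set V} (h : IsFaceOf F P) : F ⊆ P := IsExposed.subset h

theorem IsFaceOf.eq_convexHull {S : Finset V} {F : Set V}
    (h : IsFaceOf F (convexHull ℝ (S : Set V))) :
    F = convexHull ℝ ((S : Set V) ∩ F) := by
  rcases F.eq_empty_or_nonempty with rfl | hF
  · simp
  obtain ⟨l, b, hl, hFe⟩ := h.exists_support hF
  have hconv : Convex ℝ F := IsExposed.convex h (convex_convexHull ℝ _)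
  refine subset_antisymm (fun x hx => ?_) (convexHull_min inter_subset_right hconv)
  have hx' := hx
  rw [hFe] at hx'
  refine convexHull_mono ?_ (support_subset_convexHull
    (fun y hy => hl y (subset_convexHull ℝ _ hy)) hx'.1 hx'.2)
  rintro y ⟨hy, e⟩
  refine ⟨hy, ?_⟩
  rw [hFe]
  exact ⟨subset_convexHull ℝ _ hy, e⟩

theorem IsFaceOf.isPolytope {F P : Set V} (h : IsFaceOf F P) (hP : IsPolytope P) :
    IsPolytope F := by
  classical
  obtain ⟨S, rfl⟩ := hP
  refine ⟨S.filter (· ∈ F), ?_⟩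
  rw [Finset.coe_filter]
  exact h.eq_convexHull

theorem IsPolytope.finite_faces {P : Set V} (hP : IsPolytope P) : (faces P).Finite := by
  obtain ⟨S, rfl⟩ := hP
  refine (S.finite_toSet.finite_subsets.image (fun T => convexHull ℝ T)).subset ?_
  intro F hF
  exact ⟨(S : Set V) ∩ F, inter_subset_left, (IsFaceOf.eq_convexHull hF).symm⟩

theorem IsFaceOf.trans {G F P : Set V} (hP : IsPolytope P) (hG : IsFaceOf G F)
    (hF : IsFaceOf F P) : IsFaceOf G P := by
  rcases G.eq_empty_or_nonempty with rfl | hGn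
  · exact isExposed_empty
  obtain ⟨m, e, hm, hGe⟩ := hG.exists_support hGn
  obtain ⟨l, b, hl, hFe⟩ := hF.exists_support (hGn.mono hG.subset)
  obtain ⟨S, rfl⟩ := hP
  have hGconv : Convex ℝ G := IsExposed.convex hG (IsExposed.convex hF (convex_convexHull ℝ _))
  have hK : ∃ K : ℝ, ∀ s ∈ S, l s < b → K * l s + m s < K * b + e := by
    have : ∀ᶠ K : ℝ in Filter.atTop, ∀ s ∈ S, l s < b → K * l s + m s < K * b + e := by
      rw [Filter.eventually_all_finset]
      intro s _
      by_cases h : l s < b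
      · filter_upwards [Filter.eventually_gt_atTop ((m s - e) / (b - l s))] with K hK _
        rw [div_lt_iff₀ (by linarith)] at hK
        nlinarith
      · exact Filter.Eventually.of_forall fun K h' => absurd h' h
    exact this.exists
  obtain ⟨K, hK⟩ := hK
  have hS : ∀ s ∈ (S : Set V), (K • l + m) s ≤ K * b + e := by
    intro s hs
    have hsP := subset_convexHull ℝ (S : Set V) hs
    simp only [add_apply, smul_apply, smul_eq_mul]
    rcases (hl s hsP).lt_or_eq with h | h
    · exact (hK s hs h).le
    · have : m s ≤ e := hm s (hFe ▸ ⟨hsP, h⟩)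
      rw [h]; linarith
  have := isFaceOf_of_support (K • l + m) (K * b + e) (le_on_convexHull hS)
  convert this
  apply subset_antisymm
  · intro x hx
    have hxF := hG.subset hx
    have h1 : m x = e := by rw [hGe] at hx; exact hx.2
    have h2 : l x = b := by rw [hFe] at hxF; exact hxF.2
    refine ⟨hF.subset (hG.subset hx), ?_⟩
    simp [h1, h2]
  · rintro x ⟨hx, hxe⟩
    refine convexHull_min ?_ hGconv (support_subset_convexHull hS hx hxe)
    rintro s ⟨hs, hse⟩
    have hsP := subset_convexHull ℝ (S : Set V) hs
    simp only [add_apply, smul_apply, smul_eq_mul] at hse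
    rcases (hl s hsP).lt_or_eq with h | h
    · exact absurd hse (hK s hs h).ne
    · rw [hGe, hFe]
      exact ⟨⟨hsP, h⟩, by rw [h] at hse; linarith⟩

theorem IsFaceOf.mono {F Q P : Set V} (h : IsFaceOf F P) (hQ : Q ⊆ P) (hF : F ⊆ Q) :
    IsFaceOf F Q :=
  IsExposed.mono h hQ hF

theorem IsPolytope.polyDim_mono {A P : Set V} (hP : IsPolytope P) (h : A ⊆ P) :
    polyDim A ≤ polyDim P :=
  have := hP.finiteDimensional
  Submodule.finrank_mono (vectorSpan_mono ℝ h)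

theorem vectorSpan_le_ker {s : Set V} (l : V →L[ℝ] ℝ) (b : ℝ) (h : ∀ x ∈ s, l x = b) :
    vectorSpan ℝ s ≤ LinearMap.ker (l : V →ₗ[ℝ] ℝ) := by
  rw [vectorSpan_def, Submodule.span_le]
  rintro _ ⟨x, hx, y, hy, rfl⟩
  simp [h x hx, h y hy]

theorem IsFaceOf.polyDim_lt {F P : Set V} (hP : IsPolytope P) (h : IsFaceOf F P)
    (hF : F.Nonempty) (hne : F ≠ P) : polyDim F < polyDim P := by
  have := hP.finiteDimensional
  obtain ⟨l, b, hl, hFe⟩ := h.exists_support hF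
  refine Submodule.finrank_lt_finrank_of_lt (lt_of_le_of_ne (vectorSpan_mono ℝ h.subset) ?_)
  intro he
  apply hne
  obtain ⟨z, hz⟩ := hF
  refine subset_antisymm h.subset fun x hx => ?_
  have hz' : l z = b := by rw [hFe] at hz; exact hz.2
  have h1 : x -ᵥ z ∈ vectorSpan ℝ F := he ▸ vsub_mem_vectorSpan ℝ hx (h.subset hz)
  have h2 := vectorSpan_le_ker l b (by rw [hFe]; exact fun x hx => hx.2) h1
  simp only [vsub_eq_sub, LinearMap.mem_ker, ContinuousLinearMap.coe_coe, map_sub] at h2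
  rw [hFe]
  exact ⟨hx, by linarith⟩

theorem exists_functional_of_notMem (W : Submodule ℝ V) [FiniteDimensional ℝ W] {x : V}
    (hx : x ∉ W) : ∃ g : V →L[ℝ] ℝ, (∀ w ∈ W, g w = 0) ∧ 0 < g x := by
  obtain ⟨g, u, hgx, hgW⟩ := geometric_hahn_banach_point_closed W.convex
    W.closed_of_finiteDimensional hx
  have hu : u < 0 := by simpa using hgW 0 W.zero_mem
  have hW : ∀ w ∈ W, g w = 0 := by
    intro w hw
    by_contra hne
    have := hgW ((u / g w) • w) (W.smul_mem _ hw)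
    rw [map_smul, smul_eq_mul, div_mul_cancel₀ _ hne] at this
    exact lt_irrefl _ this
  exact ⟨-g, fun w hw => by simp [hW w hw], by simp; linarith⟩

/-- A face avoiding a point extends to a facet avoiding that point. -/
theorem IsFaceOf.exists_facet {F P : Set V} (hP : IsPolytope P) (h : IsFaceOf F P)
    (hF : F.Nonempty) {q : V} (hq : q ∈ P) (hqF : q ∉ F) :
    ∃ G, IsFaceOf G P ∧ F ⊆ G ∧ q ∉ G ∧ polyDim G + 1 = polyDim P := by
  obtain ⟨G, ⟨hG, hFG, hqG⟩, hmax⟩ := Set.exists_max_image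
    {G | IsFaceOf G P ∧ F ⊆ G ∧ q ∉ G} polyDim
    (hP.finite_faces.subset fun G hG => hG.1) ⟨F, h, subset_rfl, hqF⟩
  refine ⟨G, hG, hFG, hqG, ?_⟩
  have hGn := hF.mono hFG
  have hlt : polyDim G < polyDim P :=
    hG.polyDim_lt hP hGn (fun e => hqG (e ▸ hq))
  by_contra hne
  have hfd := hP.finiteDimensional
  have hfdG := (hG.isPolytope hP).finiteDimensional
  obtain ⟨l, b, hl, hGe⟩ := hG.exists_support hGn
  obtain ⟨S, hS⟩ := hP
  set W := vectorSpan ℝ (insert q G) with hW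
  have hWle : Module.finrank ℝ W ≤ polyDim G + 1 := finrank_vectorSpan_insert_le_set ℝ G q
  obtain ⟨s, hs, hsW⟩ : ∃ s ∈ S, s - q ∉ W := by
    by_contra! hcon
    have hsub : P ⊆ affineSpan ℝ (insert q G) := by
      rw [hS]
      refine convexHull_min (fun s hs => ?_) (AffineSubspace.convex _)
      have := AffineSubspace.vadd_mem_of_mem_direction
        (s := affineSpan ℝ (insert q G)) (v := s - q)
        (by rw [direction_affineSpan]; exact hcon s hs)
        (mem_affineSpan ℝ (mem_insert q G))
      simpa using this
    have hle : vectorSpan ℝ P ≤ W := by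
      have := AffineSubspace.direction_le (affineSpan_le.2 hsub)
      rwa [direction_affineSpan, direction_affineSpan] at this
    have := Submodule.finrank_mono hle
    change polyDim P ≤ _ at this
    omega
  obtain ⟨g, hgW, hgs⟩ := exists_functional_of_notMem W hsW
  have hgq : ∀ x ∈ G, g x = g q := by
    intro x hx
    have := hgW (x -ᵥ q) (vsub_mem_vectorSpan ℝ (mem_insert_of_mem _ hx) (mem_insert _ _))
    simpa [sub_eq_zero] using this
  rw [map_sub, sub_pos] at hgs
  obtain ⟨t, ht, hmin⟩ := Finset.exists_min_image (S.filter fun s => g q < g s)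
    (fun s => (b - l s) / (g s - g q)) ⟨s, by simp [hs, hgs]⟩
  simp only [Finset.mem_filter, and_imp] at ht hmin
  set r := (b - l t) / (g t - g q) with hr
  have hSP : ∀ s ∈ S, s ∈ P := fun s hs => hS ▸ subset_convexHull ℝ _ hs
  have hr0 : 0 ≤ r := div_nonneg (sub_nonneg.2 (hl t (hSP t ht.1))) (sub_nonneg.2 ht.2.le)
  have hle : ∀ s ∈ (S : Set V), (l + r • g) s ≤ b + r * g q := by
    intro s hs
    simp only [add_apply, smul_apply, smul_eq_mul]
    by_cases h : g q < g s
    · have := hmin s hs h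
      rw [le_div_iff₀ (by linarith)] at this
      linarith
    · have := hl s (hSP s hs)
      nlinarith
  have hface := isFaceOf_of_support (l + r • g) (b + r * g q) (le_on_convexHull hle)
  rw [← hS] at hface
  set G' := {x ∈ P | (l + r • g) x = b + r * g q} with hG'
  have hlG : ∀ x ∈ G, l x = b := by rw [hGe]; exact fun x hx => hx.2
  have hGG' : G ⊆ G' := fun x hx => ⟨hG.subset hx, by simp [hlG x hx, hgq x hx]⟩
  have hqG' : q ∉ G' := by
    rintro ⟨-, hq'⟩
    simp only [add_apply, smul_apply, smul_eq_mul] at hq'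
    exact hqG (by rw [hGe]; exact ⟨hq, by linarith⟩)
  have htG' : t ∈ G' := by
    refine ⟨hSP t ht.1, ?_⟩
    have h0 : g t - g q ≠ 0 := by linarith [ht.2]
    have : r * (g t - g q) = b - l t := div_mul_cancel₀ _ h0
    simp only [add_apply, smul_apply, smul_eq_mul]
    linarith
  have hlt' := IsFaceOf.polyDim_lt (hface.isPolytope ⟨S, hS⟩) (hG.mono hface.subset hGG') hGn
    (fun e => by
      have := hgq t (e ▸ htG')
      linarith [ht.2])
  exact absurd (hmax G' ⟨hface, hFG.trans hGG', hqG'⟩) (not_le.2 hlt')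

theorem exists_ne_of_polyDim_pos {P : Set V} (h : 0 < polyDim P) (q : V) : ∃ p ∈ P, p ≠ q := by
  by_contra! hcon
  have : vectorSpan ℝ P ≤ vectorSpan ℝ {q} := vectorSpan_mono ℝ hcon
  rw [vectorSpan_singleton, le_bot_iff] at this
  rw [polyDim, this, finrank_bot] at h
  exact lt_irrefl 0 h

theorem IsPolytope.exists_face_notMem {P : Set V} (hP : IsPolytope P) (h : 0 < polyDim P)
    (q : V) : ∃ F, IsFaceOf F P ∧ F.Nonempty ∧ q ∉ F := by
  obtain ⟨p, hp, hpq⟩ := exists_ne_of_polyDim_pos h q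
  obtain ⟨l, hl⟩ := geometric_hahn_banach_point_point hpq.symm
  obtain ⟨S, rfl⟩ := hP
  obtain ⟨s, hs, hmax⟩ := S.exists_max_image l
    (by rw [← Finset.coe_nonempty, ← convexHull_nonempty_iff (𝕜 := ℝ)]; exact ⟨p, hp⟩)
  have hle := le_on_convexHull (s := (S : Set V)) hmax
  refine ⟨_, isFaceOf_of_support l (l s) hle, ⟨s, subset_convexHull ℝ _ hs, rfl⟩, ?_⟩
  rintro ⟨-, e⟩
  linarith [hle p hp]

theorem IsPolytope.exists_facet_notMem {P : Set V} (hP : IsPolytope P) (h : 0 < polyDim P)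
    {q : V} (hq : q ∈ P) :
    ∃ G, IsFaceOf G P ∧ G.Nonempty ∧ q ∉ G ∧ polyDim G + 1 = polyDim P := by
  obtain ⟨F, hF, hFn, hqF⟩ := hP.exists_face_notMem h q
  obtain ⟨G, hG, hFG, hqG⟩ := hF.exists_facet hP hFn hq hqF
  exact ⟨G, hG, hFn.mono hFG, hqG⟩

theorem IsPolytope.exists_facet_mem {P : Set V} (hP : IsPolytope P) (h : 0 < polyDim P)
    {v : V} (hv : IsFaceOf {v} P) :
    ∃ G, IsFaceOf G P ∧ v ∈ G ∧ polyDim G + 1 = polyDim P := by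
  obtain ⟨p, hp, hpv⟩ := exists_ne_of_polyDim_pos h v
  obtain ⟨G, hG, hFG, -, hdim⟩ := hv.exists_facet hP (singleton_nonempty v) hp hpv
  exact ⟨G, hG, hFG rfl, hdim⟩

/-- Every polytope is the convex hull of a finite set of vertices. -/
theorem IsPolytope.exists_vertices {P : Set V} (hP : IsPolytope P) :
    ∃ S : Finset V, P = convexHull ℝ (S : Set V) ∧ ∀ s ∈ S, IsFaceOf {s} P := by
  classical
  obtain ⟨n, hn⟩ : ∃ n, ∃ S : Finset V, S.card = n ∧ P = convexHull ℝ (S : Set V) := by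
    obtain ⟨S, hS⟩ := hP
    exact ⟨_, S, rfl, hS⟩
  obtain ⟨S, hSn, hS⟩ := Nat.find_spec (⟨n, hn⟩ : ∃ n, ∃ S : Finset V, S.card = n ∧
    P = convexHull ℝ (S : Set V))
  have hmin : ∀ T : Finset V, P = convexHull ℝ (T : Set V) → S.card ≤ T.card := by
    intro T hT
    rw [hSn]
    exact Nat.find_min' _ ⟨T, rfl, hT⟩
  refine ⟨S, hS, fun s hs => ?_⟩
  have hns : s ∉ convexHull ℝ ((S.erase s : Finset V) : Set V) := by
    intro hmem
    have hP' : P = convexHull ℝ ((S.erase s : Finset V) : Set V) := by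
      rw [hS]
      refine subset_antisymm (convexHull_min (fun x hx => ?_) (convex_convexHull ℝ _))
        (convexHull_mono (by simp))
      by_cases hxs : x = s
      · rwa [hxs]
      · exact subset_convexHull ℝ _ (by simpa [hxs] using hx)
    have := hmin _ hP'
    have := Finset.card_erase_lt_of_mem hs
    omega
  obtain ⟨l, u, hlu, hus⟩ := geometric_hahn_banach_closed_point (convex_convexHull ℝ _)
    ((S.erase s).finite_toSet.isClosed_convexHull ℝ) hns
  have hlt : ∀ x ∈ S, x ≠ s → l x < l s := fun x hx hxs =>
    (hlu x (subset_convexHull ℝ _ (by simp [hx, hxs]))).trans hus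
  have hle : ∀ x ∈ (S : Set V), l x ≤ l s := fun x hx => by
    by_cases hxs : x = s
    · rw [hxs]
    · exact (hlt x hx hxs).le
  have := isFaceOf_of_support l (l s) (le_on_convexHull hle)
  rw [← hS] at this
  convert this
  refine subset_antisymm ?_ ?_
  · rintro _ rfl
    exact ⟨hS ▸ subset_convexHull ℝ _ hs, rfl⟩
  · rintro x ⟨hx, hxe⟩
    rw [hS] at hx
    have := support_subset_convexHull hle hx hxe
    refine convexHull_min (t := {s}) ?_ (convex_singleton s) this
    rintro y ⟨hy, hye⟩
    by_contra hys
    exact (hlt y hy hys).ne hye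

/-! ### Graded posets -/

theorem le_rank_orderIso {α β : Type*} [Preorder α] [Preorder β] (φ : α ≃o β) {r : α → ℕ}
    {r' : β → ℕ} (hr' : StrictMono r') (hr : ∀ a, r a ≠ 0 → ∃ b < a, r b + 1 = r a) (a : α) :
    r a ≤ r' (φ a) := by
  induction h : r a generalizing a with
  | zero => exact Nat.zero_le _
  | succ k ih =>
    obtain ⟨b, hb, hba⟩ := hr a (by omega)
    have h1 := ih b (by omega)
    have h2 := hr' (φ.lt_iff_lt.2 hb)
    omega

/-- Order isomorphisms preserve the rank function of a graded poset. -/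
theorem rank_orderIso {α β : Type*} [Preorder α] [Preorder β] (φ : α ≃o β) {r : α → ℕ}
    {r' : β → ℕ} (hrm : StrictMono r) (hrm' : StrictMono r')
    (hr : ∀ a, r a ≠ 0 → ∃ b < a, r b + 1 = r a)
    (hr' : ∀ a, r' a ≠ 0 → ∃ b < a, r' b + 1 = r' a) (a : α) :
    r' (φ a) = r a :=
  le_antisymm (by simpa using le_rank_orderIso φ.symm hrm hr' (φ a))
    (le_rank_orderIso φ hrm' hr a)

theorem polyDim_strictMono_faces_mem {P : Set V} (hP : IsPolytope P) (v : V) :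
    StrictMono fun F : {F : Set V // IsFaceOf F P ∧ v ∈ F} => polyDim F.1 := by
  intro F G h
  have hFG : F.1 ⊆ G.1 := h.le
  exact (F.2.1.mono G.2.1.subset hFG).polyDim_lt (G.2.1.isPolytope hP) ⟨v, F.2.2⟩
    fun e => h.ne (Subtype.ext e)

theorem exists_covered_face_mem {P : Set V} (hP : IsPolytope P) {v : V} (hv : IsFaceOf {v} P)
    (F : {F : Set V // IsFaceOf F P ∧ v ∈ F}) (hF : polyDim F.1 ≠ 0) :
    ∃ G < F, polyDim G.1 + 1 = polyDim F.1 := by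
  obtain ⟨G, hG, hvG, hd⟩ := (F.2.1.isPolytope hP).exists_facet_mem (Nat.pos_of_ne_zero hF)
    (hv.mono F.2.1.subset (singleton_subset_iff.2 F.2.2))
  refine ⟨⟨G, hG.trans hP F.2.1, hvG⟩, lt_of_le_of_ne hG.subset fun e => ?_, hd⟩
  have : G = F.1 := congrArg Subtype.val e
  rw [this] at hd
  omega

/-! ### Faces of the cube -/

/-- The face `{0}`, `{1}` or `[0, 1]` of the unit interval. -/
def intervalFace : Option Bool → Set ℝ
  | none => Set.Icc 0 1
  | some true => {1}
  | some false => {0}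

theorem intervalFace_nonempty (o : Option Bool) : (intervalFace o).Nonempty := by
  rcases o with _ | _ | _ <;> simp [intervalFace]

theorem intervalFace_subset_iff {o p : Option Bool} :
    intervalFace o ⊆ intervalFace p ↔ p = none ∨ o = p := by
  have h01 : ¬ (Set.Icc (0 : ℝ) 1 ⊆ {1}) := fun h => by
    simpa using h (left_mem_Icc.2 zero_le_one)
  have h02 : ¬ (Set.Icc (0 : ℝ) 1 ⊆ {0}) := fun h => by
    simpa using h (right_mem_Icc.2 zero_le_one)
  rcases o with _ | _ | _ <;> rcases p with _ | _ | _ <;>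
    simp [intervalFace, h01, h02]

/-- The face of the cube with a prescribed face of the interval in each direction. -/
def cubeFace {d : ℕ} (σ : Fin d → Option Bool) : Set (Fin d → ℝ) :=
  Set.pi univ fun i => intervalFace (σ i)

theorem cubeFace_nonempty {d : ℕ} (σ : Fin d → Option Bool) : (cubeFace σ).Nonempty :=
  univ_pi_nonempty_iff.2 fun _ => intervalFace_nonempty _

theorem cubeFace_subset_iff {d : ℕ} {σ τ : Fin d → Option Bool} :
    cubeFace σ ⊆ cubeFace τ ↔ ∀ i, τ i = none ∨ σ i = τ i := by
  rw [cubeFace, cubeFace, univ_pi_subset_univ_pi_iff]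
  simp only [intervalFace_subset_iff]
  refine or_iff_left ?_
  rintro ⟨i, hi⟩
  exact (intervalFace_nonempty (σ i)).ne_empty hi

theorem cubeFace_injective {d : ℕ} :
    Function.Injective (cubeFace : (Fin d → Option Bool) → Set (Fin d → ℝ)) := by
  intro σ τ h
  funext i
  have h1 := cubeFace_subset_iff.1 h.subset i
  have h2 := cubeFace_subset_iff.1 h.symm.subset i
  grind

/-- The coordinate sign pattern of a linear functional. -/
noncomputable def signPattern {d : ℕ} (a : Fin d → ℝ) (i : Fin d) : Option Bool :=
  if a i = 0 then none else some (decide (0 < a i))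

theorem mul_le_of_mem_intervalFace {a x y : ℝ}
    (hx : x ∈ intervalFace (if a = 0 then none else some (decide (0 < a))))
    (hy : y ∈ Set.Icc (0 : ℝ) 1) : a * y ≤ a * x := by
  rcases lt_trichotomy a 0 with h | h | h
  · have : x = 0 := by simpa [h.ne, h.le, not_lt.2 h.le, intervalFace] using hx
    subst this
    nlinarith [hy.1]
  · simp [h]
  · have : x = 1 := by simpa [h.ne', h, intervalFace] using hx
    subst this
    nlinarith [hy.2]

theorem intervalFace_subset_Icc (o : Option Bool) : intervalFace o ⊆ Set.Icc 0 1 := by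
  rcases o with _ | _ | _ <;> simp [intervalFace]

theorem maximizers_eq_cubeFace {d : ℕ} (a : Fin d → ℝ) :
    {x ∈ Set.Icc (0 : Fin d → ℝ) 1 | ∀ y ∈ Set.Icc (0 : Fin d → ℝ) 1,
      ∑ i, a i * y i ≤ ∑ i, a i * x i} = cubeFace (signPattern a) := by
  ext x
  constructor
  · rintro ⟨hx, hmax⟩ i -
    have hupd : ∀ t ∈ Set.Icc (0 : ℝ) 1, a i * t ≤ a i * x i := by
      intro t ht
      have := hmax (Function.update x i t) (by
        rw [← pi_univ_Icc] at hx ⊢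
        intro j _
        rcases eq_or_ne j i with rfl | hj
        · simpa using ht
        · simpa [hj] using hx j trivial)
      rw [← Finset.add_sum_erase _ _ (Finset.mem_univ i),
        ← Finset.add_sum_erase _ (fun i => a i * x i) (Finset.mem_univ i)] at this
      rw [Finset.sum_congr rfl (g := fun i => a i * x i) (fun j hj => by
        rw [Function.update_of_ne (Finset.ne_of_mem_erase hj)])] at this
      rw [Function.update_self] at this
      exact le_of_add_le_add_right this
    have h0 := hx.1 i
    have h1 := hx.2 i
    simp only [Pi.zero_apply, Pi.one_apply] at h0 h1
    have hu0 := hupd 0 (by simp)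
    have hu1 := hupd 1 (by simp)
    simp only [signPattern]
    rcases lt_trichotomy (a i) 0 with h | h | h
    · have : x i = 0 := by nlinarith
      simp [h.ne, not_lt.2 h.le, intervalFace, this]
    · simp [h, intervalFace, h0, h1]
    · have : x i = 1 := by nlinarith
      simp [h.ne', h, intervalFace, this]
  · intro hx
    refine ⟨?_, fun y hy => Finset.sum_le_sum fun i _ => ?_⟩
    · rw [← pi_univ_Icc]
      exact fun i hi => intervalFace_subset_Icc _ (hx i hi)
    · exact mul_le_of_mem_intervalFace (hx i trivial) ⟨hy.1 i, hy.2 i⟩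

theorem isFaceOf_cube_iff {d : ℕ} {F : Set (Fin d → ℝ)} (hF : F.Nonempty) :
    IsFaceOf F (Set.Icc (0 : Fin d → ℝ) 1) ↔ ∃ σ, F = cubeFace σ := by
  constructor
  · intro h
    obtain ⟨l, hl⟩ := h hF
    refine ⟨signPattern fun i => l (Pi.single i 1), ?_⟩
    rw [← maximizers_eq_cubeFace, hl]
    have : ∀ x, ∑ i, l (Pi.single i 1) * x i = l x := by
      intro x
      have := (congrArg l (pi_eq_sum_univ' x)).symm
      simpa only [map_sum, map_smul, smul_eq_mul, mul_comm (x _)] using this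
    simp only [this]
  · rintro ⟨σ, rfl⟩ -
    let a : Fin d → ℝ := fun i => (σ i).elim 0 fun b => if b then 1 else -1
    have ha : signPattern a = σ := by
      funext i
      rcases h : σ i with _ | _ | _ <;> simp [signPattern, a, h]
    refine ⟨∑ i, a i • ContinuousLinearMap.proj i, ?_⟩
    rw [← ha, ← maximizers_eq_cubeFace]
    simp

open scoped Classical in
/-- The rank of a face in the face lattice of the cube. -/
noncomputable def cubeRank {d : ℕ} (F : Set (Fin d → ℝ)) : ℕ :=
  if h : ∃ σ, F = cubeFace σ then (Finset.univ.filter fun i => h.choose i = none).card + 1 else 0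

theorem cubeRank_cubeFace {d : ℕ} (σ : Fin d → Option Bool) :
    cubeRank (cubeFace σ) = (Finset.univ.filter fun i => σ i = none).card + 1 := by
  have h : ∃ τ, cubeFace σ = cubeFace τ := ⟨σ, rfl⟩
  rw [cubeRank, dif_pos h, cubeFace_injective h.choose_spec.symm]

theorem cubeRank_empty (d : ℕ) : cubeRank (∅ : Set (Fin d → ℝ)) = 0 :=
  dif_neg fun ⟨σ, h⟩ => (cubeFace_nonempty σ).ne_empty h.symm

theorem eq_empty_or_cubeFace {d : ℕ} {F : Set (Fin d → ℝ)}
    (h : IsFaceOf F (Set.Icc (0 : Fin d → ℝ) 1)) : F = ∅ ∨ ∃ σ, F = cubeFace σ :=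
  F.eq_empty_or_nonempty.imp_right fun hF => (isFaceOf_cube_iff hF).1 h

theorem isFaceOf_cubeFace {d : ℕ} (σ : Fin d → Option Bool) :
    IsFaceOf (cubeFace σ) (Set.Icc (0 : Fin d → ℝ) 1) :=
  (isFaceOf_cube_iff (cubeFace_nonempty σ)).2 ⟨σ, rfl⟩

theorem cubeRank_strictMono (d : ℕ) : StrictMono
    fun F : {F : Set (Fin d → ℝ) // IsFaceOf F (Set.Icc (0 : Fin d → ℝ) 1)} => cubeRank F.1 := by
  rintro ⟨F, hF⟩ ⟨G, hG⟩ h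
  have hsub : F ⊆ G := h.le
  have hne : F ≠ G := fun e => h.ne (Subtype.ext e)
  change cubeRank F < cubeRank G
  rcases eq_empty_or_cubeFace hG with rfl | ⟨τ, rfl⟩
  · exact absurd (subset_empty_iff.1 hsub) hne
  rcases eq_empty_or_cubeFace hF with rfl | ⟨σ, rfl⟩
  · rw [cubeRank_empty, cubeRank_cubeFace]
    exact Nat.succ_pos _
  rw [cubeRank_cubeFace, cubeRank_cubeFace, Nat.succ_lt_succ_iff]
  rw [cubeFace_subset_iff] at hsub
  obtain ⟨i, hi⟩ : ∃ i, σ i ≠ τ i := by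
    by_contra! hcon
    exact hne (congrArg cubeFace (funext hcon))
  refine Finset.card_lt_card (Finset.ssubset_iff_of_subset ?_ |>.2 ⟨i, ?_, ?_⟩)
  · intro j
    have := hsub j
    simp only [Finset.mem_filter, Finset.mem_univ, true_and]
    grind
  · have := hsub i
    simp only [Finset.mem_filter, Finset.mem_univ, true_and]
    grind
  · have := hsub i
    simp only [Finset.mem_filter, Finset.mem_univ, true_and]
    grind

theorem exists_covered_cube_face {d : ℕ}
    (F : {F : Set (Fin d → ℝ) // IsFaceOf F (Set.Icc (0 : Fin d → ℝ) 1)})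
    (hF : cubeRank F.1 ≠ 0) : ∃ G < F, cubeRank G.1 + 1 = cubeRank F.1 := by
  obtain ⟨F, hFace⟩ := F
  change cubeRank F ≠ 0 at hF
  rcases eq_empty_or_cubeFace hFace with rfl | ⟨σ, rfl⟩
  · exact absurd (cubeRank_empty d) hF
  by_cases h : ∃ i, σ i = none
  · obtain ⟨i, hi⟩ := h
    have hcard : cubeRank (cubeFace (Function.update σ i (some false))) + 1
        = cubeRank (cubeFace σ) := by
      rw [cubeRank_cubeFace, cubeRank_cubeFace]
      have : (Finset.univ.filter fun j => Function.update σ i (some false) j = none)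
          = (Finset.univ.filter fun j => σ j = none).erase i := by
        ext j
        rcases eq_or_ne j i with rfl | hj <;> simp [*]
      rw [this, Finset.card_erase_add_one (by simp [hi])]
    refine ⟨⟨_, isFaceOf_cubeFace (Function.update σ i (some false))⟩,
      lt_of_le_of_ne ?_ fun e => ?_, hcard⟩
    · refine cubeFace_subset_iff.2 fun j => ?_
      rcases eq_or_ne j i with rfl | hj <;> simp [*]
    · have := congrArg Subtype.val e
      simp only at this
      rw [this] at hcard
      omega
  · push Not at h
    refine ⟨⟨∅, isExposed_empty⟩, lt_of_le_of_ne (empty_subset _) fun e => ?_, ?_⟩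
    · exact (cubeFace_nonempty σ).ne_empty (congrArg Subtype.val e).symm
    · change cubeRank (∅ : Set (Fin d → ℝ)) + 1 = cubeRank (cubeFace σ)
      rw [cubeRank_empty, cubeRank_cubeFace, Finset.filter_false_of_mem fun i _ => h i,
        Finset.card_empty]

theorem sum_cube_X_pow (d : ℕ) : ∑ σ : Fin d → Option Bool,
    (X : ℚ[X]) ^ (Finset.univ.filter fun i => σ i = none).card = (X + 2) ^ d := by
  calc _ = ∑ σ : Fin d → Option Bool, ∏ i, (if σ i = none then (X : ℚ[X]) else 1) := by
        refine Finset.sum_congr rfl fun σ _ => ?_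
        rw [Finset.prod_ite, Finset.prod_const, Finset.prod_const_one, mul_one]
    _ = ∏ _i : Fin d, ∑ o : Option Bool, (if o = none then (X : ℚ[X]) else 1) := by
        rw [Finset.prod_univ_sum, Fintype.piFinset_univ]
    _ = (X + 2) ^ d := by
        rw [Finset.prod_const, Finset.card_univ, Fintype.card_fin, Fintype.sum_option]
        simp

theorem finsum_cubeRank (d : ℕ) :
    ∑ᶠ F : {F : Set (Fin d → ℝ) // IsFaceOf F (Set.Icc (0 : Fin d → ℝ) 1)},
      (X : ℚ[X]) ^ cubeRank F.1 = 1 + X * (X + 2) ^ d := by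
  let f : Option (Fin d → Option Bool) →
      {F : Set (Fin d → ℝ) // IsFaceOf F (Set.Icc (0 : Fin d → ℝ) 1)} :=
    fun o => o.elim ⟨∅, isExposed_empty⟩ fun σ => ⟨cubeFace σ, isFaceOf_cubeFace σ⟩
  have hf : Function.Bijective f := by
    constructor
    · rintro (_ | σ) (_ | τ) h
      · rfl
      · exact absurd (congrArg Subtype.val h).symm (cubeFace_nonempty τ).ne_empty
      · exact absurd (congrArg Subtype.val h) (cubeFace_nonempty σ).ne_empty
      · exact congrArg some (cubeFace_injective (congrArg Subtype.val h))
    · rintro ⟨F, hF⟩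
      rcases eq_empty_or_cubeFace hF with rfl | ⟨σ, rfl⟩
      · exact ⟨none, rfl⟩
      · exact ⟨some σ, rfl⟩
  rw [← finsum_comp_equiv (Equiv.ofBijective f hf), finsum_eq_sum_of_fintype, Fintype.sum_option]
  have h0 : cubeRank ((Equiv.ofBijective f hf) none).1 = 0 := cubeRank_empty d
  have h1 : ∀ σ, cubeRank ((Equiv.ofBijective f hf) (some σ)).1
      = (Finset.univ.filter fun i => σ i = none).card + 1 := fun σ => cubeRank_cubeFace σ
  simp only [h0, h1, pow_zero, pow_succ', ← Finset.mul_sum, sum_cube_X_pow]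

/-! ### Slices at a vertex -/

theorem exists_lineMap_apply_eq {f : V →L[ℝ] ℝ} {c : ℝ} {v s : V} (hv : c < f v) (hs : f s < c) :
    ∃ t : ℝ, 0 < t ∧ t < 1 ∧ f (AffineMap.lineMap v s t) = c := by
  have h : 0 < f v - f s := by linarith
  refine ⟨(f v - c) / (f v - f s), by apply div_pos <;> linarith,
    by rw [div_lt_one h]; linarith, ?_⟩
  rw [AffineMap.lineMap_apply_module', map_add, map_smul, map_sub, smul_eq_mul]
  field_simp
  ring

theorem orderIso_faces_slice {E : Set V} (hE : IsPolytope E) {v : V} (hv : IsFaceOf {v} E)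
    {f : V →L[ℝ] ℝ} {c : ℝ} (hfv : c < f v) (hf : ∀ w, IsFaceOf {w} E → w ≠ v → f w < c) :
    Nonempty ({F : Set V // IsFaceOf F E ∧ v ∈ F} ≃o
      {G : Set V // IsFaceOf G {x ∈ E | f x = c}}) := by
  obtain ⟨S, hS, hSv⟩ := hE.exists_vertices
  set Q := {x ∈ E | f x = c} with hQ
  have hvE : v ∈ E := hv.subset rfl
  have hSE : ∀ s ∈ S, s ∈ E := fun s hs => (hSv s hs).subset rfl
  have hconv := hE.convex
  have hQE : Q ⊆ E := fun x hx => hx.1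
  have hface : ∀ F, IsFaceOf F E → IsFaceOf (F ∩ Q) Q := fun F hF => by
    rcases F.eq_empty_or_nonempty with rfl | hFn
    · rw [empty_inter]; exact isExposed_empty
    obtain ⟨l, b, hl, hFe⟩ := hF.exists_support hFn
    convert isFaceOf_of_support l b fun x hx => hl x (hQE hx) using 1
    rw [hFe]
    ext x
    exact ⟨fun h => ⟨h.2, h.1.2⟩, fun h => ⟨⟨hQE h.1, h.2⟩, h.1⟩⟩
  let φ : {F : Set V // IsFaceOf F E ∧ v ∈ F} ↪o {G : Set V // IsFaceOf G Q} :=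
    OrderEmbedding.ofMapLEIff (fun F => ⟨F.1 ∩ Q, hface F.1 F.2.1⟩) (by
      rintro ⟨F, hF, hvF⟩ ⟨G, hG, hvG⟩
      refine ⟨fun h => ?_, fun h => inter_subset_inter_left _ h⟩
      change F ∩ Q ⊆ G ∩ Q at h
      change F ⊆ G
      obtain ⟨l, b, hl, hGe⟩ := hG.exists_support ⟨v, hvG⟩
      have hGconv : Convex ℝ G := IsExposed.convex hG hconv
      have hFconv : Convex ℝ F := IsExposed.convex hF hconv
      have hFS : F = convexHull ℝ ((S : Set V) ∩ F) := by
        rw [hS] at hF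
        exact hF.eq_convexHull
      rw [hFS]
      refine convexHull_min ?_ hGconv
      rintro s ⟨hs, hsF⟩
      by_cases hsv : s = v
      · rwa [hsv]
      obtain ⟨t, ht0, ht1, ht⟩ := exists_lineMap_apply_eq hfv (hf s (hSv s hs) hsv)
      have huF : AffineMap.lineMap v s t ∈ F :=
        hFconv.lineMap_mem hvF hsF ⟨ht0.le, ht1.le⟩
      have huG := (h ⟨huF, hF.subset huF, ht⟩).1
      rw [hGe] at huG hvG ⊢
      refine ⟨hSE s hs, ?_⟩
      have h1 := huG.2
      have h2 := hvG.2
      rw [AffineMap.lineMap_apply_module', map_add, map_smul, map_sub, smul_eq_mul] at h1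
      have : t * (l s - b) = 0 := by rw [h2] at h1; linarith
      have := (mul_eq_zero.1 this).resolve_left ht0.ne'
      linarith)
  refine ⟨RelIso.ofSurjective φ ?_⟩
  rintro ⟨G, hG⟩
  rcases G.eq_empty_or_nonempty with rfl | hGn
  · refine ⟨⟨{v}, hv, rfl⟩, Subtype.ext ?_⟩
    change {v} ∩ Q = ∅
    rw [singleton_inter_eq_empty]
    rintro ⟨-, h⟩
    exact hfv.ne' h
  obtain ⟨l, b, hl, hGe⟩ := hG.exists_support hGn
  set k := (b - l v) / (f v - c) with hk
  have hkv : k * (f v - c) = b - l v := div_mul_cancel₀ _ (by linarith)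
  have hle : ∀ s ∈ (S : Set V), (l + k • f) s ≤ b + k * c := by
    intro s hs
    simp only [add_apply, smul_apply, smul_eq_mul]
    by_cases hsv : s = v
    · rw [hsv]; linarith
    obtain ⟨t, ht0, ht1, ht⟩ := exists_lineMap_apply_eq hfv (hf s (hSv s hs) hsv)
    have huQ : AffineMap.lineMap v s t ∈ Q :=
      ⟨hconv.lineMap_mem hvE (hSE s hs) ⟨ht0.le, ht1.le⟩, ht⟩
    have h1 := hl _ huQ
    rw [AffineMap.lineMap_apply_module', map_add, map_smul, map_sub, smul_eq_mul] at h1 ht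
    have h2 : t * (l s + k * f s - (b + k * c)) ≤ 0 := by
      linear_combination h1 + k * ht + (t - 1) * hkv
    nlinarith [nonpos_of_mul_nonpos_right h2 ht0]
  have hF := isFaceOf_of_support (l + k • f) (b + k * c) (le_on_convexHull hle)
  rw [← hS] at hF
  refine ⟨⟨_, hF, hvE, ?_⟩, Subtype.ext ?_⟩
  · simp only [add_apply, smul_apply, smul_eq_mul]
    linarith
  · change {x ∈ E | (l + k • f) x = b + k * c} ∩ Q = G
    rw [hGe]
    ext x
    constructor
    · rintro ⟨⟨-, h⟩, hxQ⟩
      simp only [add_apply, smul_apply, smul_eq_mul, hxQ.2] at h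
      exact ⟨hxQ, by linarith⟩
    · rintro ⟨hxQ, h⟩
      refine ⟨⟨hQE hxQ, ?_⟩, hxQ⟩
      simp only [add_apply, smul_apply, smul_eq_mul, hxQ.2, h]

theorem polyDim_slice_add_one {E : Set V} (hE : IsPolytope E) {v : V} (hv : IsFaceOf {v} E)
    {f : V →L[ℝ] ℝ} {c : ℝ} (hfv : c < f v) (hf : ∀ w, IsFaceOf {w} E → w ≠ v → f w < c)
    (hpos : 0 < polyDim E) : polyDim {x ∈ E | f x = c} + 1 = polyDim E := by
  obtain ⟨S, hS, hSv⟩ := hE.exists_vertices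
  have hfd := hE.finiteDimensional
  set Q := {x ∈ E | f x = c} with hQ
  have hvE : v ∈ E := hv.subset rfl
  have hSE : ∀ s ∈ S, s ∈ E := fun s hs => (hSv s hs).subset rfl
  have hray : ∀ s ∈ S, s ≠ v → ∃ t : ℝ, 0 < t ∧ AffineMap.lineMap v s t ∈ Q := by
    intro s hs hsv
    obtain ⟨t, ht0, ht1, ht⟩ := exists_lineMap_apply_eq hfv (hf s (hSv s hs) hsv)
    exact ⟨t, ht0, hE.convex.lineMap_mem hvE (hSE s hs) ⟨ht0.le, ht1.le⟩, ht⟩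
  have hQE : Q ⊆ E := fun x hx => hx.1
  have hfdQ : FiniteDimensional ℝ (vectorSpan ℝ Q) :=
    Submodule.finiteDimensional_of_le (vectorSpan_mono ℝ hQE)
  obtain ⟨p, hp⟩ : Q.Nonempty := by
    obtain ⟨s, hs, hsv⟩ : ∃ s ∈ S, s ≠ v := by
      by_contra! hcon
      obtain ⟨p, hp, hpv⟩ := exists_ne_of_polyDim_pos hpos v
      rw [hS] at hp
      exact hpv (convexHull_min (t := {v}) hcon (convex_singleton v) hp)
    obtain ⟨t, -, h⟩ := hray s hs hsv
    exact ⟨_, h⟩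
  have hspan : vectorSpan ℝ E = vectorSpan ℝ (insert v Q) := by
    refine le_antisymm ?_ (vectorSpan_mono ℝ (insert_subset hvE hQE))
    have hsub : E ⊆ affineSpan ℝ (insert v Q) := by
      rw [hS]
      refine convexHull_min (fun s hs => ?_) (AffineSubspace.convex _)
      have hvm := mem_affineSpan ℝ (mem_insert v Q)
      by_cases hsv : s = v
      · rwa [hsv]
      obtain ⟨t, ht0, ht⟩ := hray s hs hsv
      have := AffineMap.lineMap_mem t⁻¹ hvm (mem_affineSpan ℝ (mem_insert_of_mem v ht))
      convert this
      simp [AffineMap.lineMap_apply_module', smul_smul, inv_mul_cancel₀ ht0.ne']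
    have := AffineSubspace.direction_le (affineSpan_le.2 hsub)
    rwa [direction_affineSpan, direction_affineSpan] at this
  have h1 : polyDim E ≤ polyDim Q + 1 := by
    rw [polyDim, hspan]
    exact finrank_vectorSpan_insert_le_set ℝ Q v
  have h2 : polyDim Q < polyDim E := by
    refine Submodule.finrank_lt_finrank_of_lt (lt_of_le_of_ne (vectorSpan_mono ℝ hQE) fun e => ?_)
    have h := vsub_mem_vectorSpan ℝ hvE (hQE hp)
    rw [← e] at h
    have := vectorSpan_le_ker f c (fun x hx => hx.2) h
    simp only [vsub_eq_sub, LinearMap.mem_ker, ContinuousLinearMap.coe_coe, map_sub, hp.2] at this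
    linarith
  omega

theorem finsum_faces_mem_of_isCombCube {E : Set V} (hE : IsPolytope E) {v : V}
    (hv : IsFaceOf {v} E) {f : V →L[ℝ] ℝ} {c : ℝ} (hfv : c < f v)
    (hf : ∀ w, IsFaceOf {w} E → w ≠ v → f w < c) {d : ℕ}
    (hd : IsCombCube {x ∈ E | f x = c} d) :
    polyDim E = d + 1 ∧
      ∑ᶠ F ∈ {F : Set V | IsFaceOf F E ∧ v ∈ F}, (X : ℚ[X]) ^ polyDim F = 1 + X * (X + 2) ^ d := by
  obtain ⟨φ⟩ := orderIso_faces_slice hE hv hfv hf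
  obtain ⟨ψ⟩ := hd
  have hrank := rank_orderIso (φ.trans ψ) (polyDim_strictMono_faces_mem hE v)
    (cubeRank_strictMono d) (exists_covered_face_mem hE hv) exists_covered_cube_face
  constructor
  · have htop : ((φ.trans ψ) ⟨E, IsExposed.refl E, hv.subset rfl⟩).1 =
        cubeFace fun _ => none := by
      refine subset_antisymm ((IsFaceOf.subset
        ((φ.trans ψ) ⟨E, IsExposed.refl E, hv.subset rfl⟩).2).trans ?_) ?_
      · rw [cubeFace, ← pi_univ_Icc]
        exact subset_rfl
      · let G : {F : Set (Fin d → ℝ) // IsFaceOf F (Set.Icc (0 : Fin d → ℝ) 1)} :=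
          ⟨cubeFace fun _ => none, isFaceOf_cubeFace _⟩
        have hle : (φ.trans ψ).symm G ≤ ⟨E, IsExposed.refl E, hv.subset rfl⟩ :=
          ((φ.trans ψ).symm G).2.1.subset
        exact (OrderIso.symm_apply_le _).1 hle
    have h := hrank ⟨E, IsExposed.refl E, hv.subset rfl⟩
    rw [htop, cubeRank_cubeFace] at h
    simpa using h.symm
  · rw [← finsum_set_coe_eq_finsum_mem, ← finsum_cubeRank d,
      ← finsum_comp_equiv (φ.trans ψ).toEquiv]
    exact finsum_congr fun F => congrArg _ (hrank F).symm

/-! ### Conic sequences -/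

theorem sum_comp_eq_sum_card {α : Type*} (T : Finset α) (r : α → ℕ) (R : Finset ℕ)
    (h : ∀ a ∈ T, r a ∈ R) (g : ℕ → ℚ[X]) :
    ∑ a ∈ T, g (r a) =
      ∑ k ∈ R, Polynomial.C ((Nat.card {a // a ∈ T ∧ r a = k} : ℚ)) * g k := by
  rw [← Finset.sum_fiberwise_of_maps_to h]
  refine Finset.sum_congr rfl fun k _ => ?_
  rw [Nat.subtype_card (T.filter fun a => r a = k) (by simp),
    Finset.sum_congr rfl (g := fun _ => g k) (fun a ha => by rw [(Finset.mem_filter.1 ha).2]),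
    Finset.sum_const, nsmul_eq_mul, map_natCast]

namespace ConicSeq

variable {P : Set V} {ℓ : ℕ}

theorem mem_cpx_pred_iff (cs : ConicSeq (faces P) ℓ) {i : ℕ} (h2 : 2 ≤ i) (hi : i ≤ ℓ)
    {F : Set V} : F ∈ cs.cpx (i - 1) ↔ F ∈ cs.cpx i ∧ cs.v i ∉ F := by
  rw [cs.step i h2 hi]
  constructor
  · rintro ⟨hF, h⟩
    exact ⟨hF, fun hv => h ⟨hF, hv, cs.E_greatest i h2 hi F hF hv⟩⟩
  · rintro ⟨hF, h⟩
    exact ⟨hF, fun h' => h h'.2.1⟩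

theorem isFaceOf_and_mem_of_subset (cs : ConicSeq (faces P) ℓ) {i : ℕ} (h1 : 1 ≤ i)
    (hi : i ≤ ℓ) : (∀ F ∈ cs.cpx i, IsFaceOf F P) ∧
      ∀ F ∈ cs.cpx i, ∀ G, IsFaceOf G P → G ⊆ F → G ∈ cs.cpx i := by
  refine Nat.decreasingInduction' (P := fun i => (∀ F ∈ cs.cpx i, IsFaceOf F P) ∧
    ∀ F ∈ cs.cpx i, ∀ G, IsFaceOf G P → G ⊆ F → G ∈ cs.cpx i) ?_ hi ?_
  · rintro k hk hik ⟨hA, hB⟩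
    have hmem : ∀ F, F ∈ cs.cpx k ↔ F ∈ cs.cpx (k + 1) ∧ cs.v (k + 1) ∉ F := fun F =>
      cs.mem_cpx_pred_iff (i := k + 1) (by omega) hk
    refine ⟨fun F hF => hA F ((hmem F).1 hF).1, fun F hF G hG hGF => ?_⟩
    rw [hmem] at hF ⊢
    exact ⟨hB F hF.1 G hG hGF, fun hv => hF.2 (hGF hv)⟩
  · rw [cs.top]
    exact ⟨fun F hF => hF, fun _ _ G hG _ => hG⟩

theorem isFaceOf (cs : ConicSeq (faces P) ℓ) {i : ℕ} (h1 : 1 ≤ i) (hi : i ≤ ℓ) {F : Set V}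
    (hF : F ∈ cs.cpx i) : IsFaceOf F P :=
  (cs.isFaceOf_and_mem_of_subset h1 hi).1 F hF

theorem mem_cpx_of_isFaceOf (cs : ConicSeq (faces P) ℓ) (hP : IsPolytope P) {i : ℕ} (h1 : 1 ≤ i)
    (hi : i ≤ ℓ) {F G : Set V} (hF : F ∈ cs.cpx i) (hG : IsFaceOf G F) : G ∈ cs.cpx i :=
  (cs.isFaceOf_and_mem_of_subset h1 hi).2 F hF G (hG.trans hP (cs.isFaceOf h1 hi hF)) hG.subset

theorem isFaceOf_v (cs : ConicSeq (faces P) ℓ) {i : ℕ} (h2 : 2 ≤ i) (hi : i ≤ ℓ) :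
    IsFaceOf {cs.v i} (cs.E i) :=
  (cs.isFaceOf (by omega) hi (cs.vtx_mem i h2 hi)).mono
    (cs.isFaceOf (by omega) hi (cs.E_mem i h2 hi)).subset
    (singleton_subset_iff.2 (cs.v_mem_E i h2 hi))

theorem isPolytope_E (cs : ConicSeq (faces P) ℓ) (hP : IsPolytope P) {i : ℕ} (h2 : 2 ≤ i)
    (hi : i ≤ ℓ) : IsPolytope (cs.E i) :=
  (cs.isFaceOf (by omega) hi (cs.E_mem i h2 hi)).isPolytope hP

theorem cpx_eq_union (cs : ConicSeq (faces P) ℓ) (hP : IsPolytope P) {i : ℕ} (h2 : 2 ≤ i)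
    (hi : i ≤ ℓ) :
    cs.cpx i \ {∅} = (cs.cpx (i - 1) \ {∅}) ∪ {F | IsFaceOf F (cs.E i) ∧ cs.v i ∈ F} := by
  ext F
  simp only [mem_sdiff, mem_union, mem_singleton_iff, mem_ofPred_eq, cs.mem_cpx_pred_iff h2 hi]
  constructor
  · rintro ⟨hF, hne⟩
    by_cases hv : cs.v i ∈ F
    · exact Or.inr ⟨(cs.isFaceOf (by omega) hi hF).mono
        (cs.isFaceOf (by omega) hi (cs.E_mem i h2 hi)).subset
        (cs.E_greatest i h2 hi F hF hv), hv⟩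
    · exact Or.inl ⟨⟨hF, hv⟩, hne⟩
  · rintro (⟨⟨hF, -⟩, hne⟩ | ⟨hF, hv⟩)
    · exact ⟨hF, hne⟩
    · exact ⟨cs.mem_cpx_of_isFaceOf hP (by omega) hi (cs.E_mem i h2 hi) hF,
        fun e => by simp [e] at hv⟩

theorem finsum_interval (cs : ConicSeq (faces P) ℓ) (hP : IsPolytope P) {C : ℕ → Set V}
    (hC : cs.HasSlices C) (hcube : ∀ i, 2 ≤ i → i ≤ ℓ → ∃ d, IsCombCube (C i) d) {i : ℕ}
    (h2 : 2 ≤ i) (hi : i ≤ ℓ) : polyDim (C i) + 1 = polyDim (cs.E i) ∧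
      ∑ᶠ F ∈ {F : Set V | IsFaceOf F (cs.E i) ∧ cs.v i ∈ F}, (X : ℚ[X]) ^ polyDim F
        = 1 + X * (X + 2) ^ polyDim (C i) := by
  obtain ⟨f, c, hfv, hf, hCi⟩ := hC i h2 hi
  obtain ⟨d, hd⟩ := hcube i h2 hi
  rw [hCi] at hd ⊢
  have hE := cs.isPolytope_E hP h2 hi
  have hv := cs.isFaceOf_v h2 hi
  have hf' : ∀ w, IsFaceOf {w} (cs.E i) → w ≠ cs.v i → f w < c := by
    intro w hw hne
    refine hf w ⟨⟨{w}, ?_, rfl⟩, hw.subset rfl⟩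
    rw [cs.mem_cpx_pred_iff h2 hi]
    exact ⟨cs.mem_cpx_of_isFaceOf hP (by omega) hi (cs.E_mem i h2 hi) hw, fun h => hne h.symm⟩
  obtain ⟨hdim, hsum⟩ := finsum_faces_mem_of_isCombCube hE hv hfv hf' hd
  have hslice := polyDim_slice_add_one hE hv hfv hf' (by omega)
  refine ⟨hslice, ?_⟩
  rw [hsum, show polyDim {x ∈ cs.E i | f x = c} = d by omega]

theorem finsum_cpx (cs : ConicSeq (faces P) ℓ) (hP : IsPolytope P) {C : ℕ → Set V}
    (hC : cs.HasSlices C) (hcube : ∀ i, 2 ≤ i → i ≤ ℓ → ∃ d, IsCombCube (C i) d) {i : ℕ}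
    (h1 : 1 ≤ i) (hi : i ≤ ℓ) : ∑ᶠ F ∈ cs.cpx i \ {∅}, (X : ℚ[X]) ^ polyDim F
      = 1 + ∑ j ∈ Finset.Icc 2 i, (1 + X * (X + 2) ^ polyDim (C j)) := by
  induction i, h1 using Nat.le_induction with
  | base =>
    have : cs.cpx 1 \ {∅} = {{cs.v 1}} := by
      rw [cs.bottom]
      ext F
      simp only [mem_sdiff, mem_insert_iff, mem_singleton_iff]
      constructor
      · rintro ⟨h | h, hne⟩
        · exact absurd h hne
        · exact h
      · rintro rfl
        exact ⟨Or.inr rfl, (singleton_nonempty _).ne_empty⟩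
    rw [this, finsum_mem_singleton, polyDim, vectorSpan_singleton, finrank_bot]
    simp
  | succ i h1 ih =>
    have hfin : (cs.cpx i \ {∅}).Finite :=
      hP.finite_faces.subset fun F hF => cs.isFaceOf h1 (by omega) hF.1
    have hE := cs.isPolytope_E hP (i := i + 1) (by omega) hi
    rw [cs.cpx_eq_union hP (i := i + 1) (by omega) hi, Nat.add_sub_cancel, finsum_mem_union ?_ hfin
      (hE.finite_faces.subset fun F hF => hF.1), ih (by omega),
      (cs.finsum_interval hP hC hcube (i := i + 1) (by omega) hi).2,
      Finset.sum_Icc_succ_top (by omega), add_assoc]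
    rw [disjoint_left]
    rintro F ⟨hF, -⟩ ⟨-, hv⟩
    exact ((cs.mem_cpx_pred_iff (i := i + 1) (by omega) hi).1 hF).2 hv

/-- Every positive dimension up to `dim P` is the dimension of some cone `E_i`. -/
theorem exists_polyDim_E_eq (cs : ConicSeq (faces P) ℓ) (hP : IsPolytope P) {k : ℕ} (hk : 1 ≤ k)
    (hkP : k ≤ polyDim P) : ∃ i, 2 ≤ i ∧ i ≤ ℓ ∧ polyDim (cs.E i) = k := by
  classical
  have hex : ∃ i, 1 ≤ i ∧ i ≤ ℓ ∧ ∃ F ∈ cs.cpx i, k ≤ polyDim F :=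
    ⟨ℓ, cs.one_le, le_rfl, P, by rw [cs.top]; exact IsExposed.refl P, hkP⟩
  obtain ⟨h1, hi, F, hF, hkF⟩ := Nat.find_spec hex
  have hmin := fun m => Nat.find_min (m := m) hex
  set i := Nat.find hex
  have h2 : 2 ≤ i := by
    by_contra hlt
    have hi1 : i = 1 := by omega
    rw [hi1, cs.bottom] at hF
    have : polyDim F = 0 := by
      rcases hF with rfl | rfl
      · rw [polyDim, vectorSpan_empty, finrank_bot]
      · rw [polyDim, vectorSpan_singleton, finrank_bot]
    omega
  have hpred : ∀ G ∈ cs.cpx (i - 1), polyDim G < k := by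
    intro G hG
    by_contra hle
    exact hmin (i - 1) (by omega) ⟨by omega, by omega, G, hG, not_lt.1 hle⟩
  have hE := cs.isPolytope_E hP h2 hi
  have hvF : cs.v i ∈ F := by
    by_contra hv
    have := hpred F ((cs.mem_cpx_pred_iff h2 hi).2 ⟨hF, hv⟩)
    omega
  have hkE := hE.polyDim_mono (cs.E_greatest i h2 hi F hF hvF)
  obtain ⟨G, hG, -, hvG, hdim⟩ := hE.exists_facet_notMem (by omega) (cs.v_mem_E i h2 hi)
  have := hpred G ((cs.mem_cpx_pred_iff h2 hi).2
    ⟨cs.mem_cpx_of_isFaceOf hP h1 hi (cs.E_mem i h2 hi) hG, hvG⟩)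
  exact ⟨i, h2, hi, by omega⟩

end ConicSeq

/-- Let `P` be an `n`-dimensional convex polytope admitting a conic sequence whose
corresponding sequence `𝒞 = {C_2, …, C_ℓ}` consists of cubes. Then
`∑_{k=0}^n f_k(P) x^k = 1 + ∑_{k=1}^n h_k^□ (1 + x(x+2)^{k-1})`, where `h_k^□` is the
number of `(k-1)`-dimensional cubes among `C_2, …, C_ℓ`, and `h_k^□ ≥ 1` for `1 ≤ k ≤ n`. -/
theorem cubical_conic_face_generating_function
    {V : Type*} [NormedAddCommGroup V] [NormedSpace ℝ V]
    (P : Set V) (hP : IsPolytope P) (n : ℕ) (hn : polyDim P = n)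
    (ℓ : ℕ) (cs : ConicSeq (faces P) ℓ) (C : ℕ → Set V) (hC : cs.HasSlices C)
    (hcube : ∀ i, 2 ≤ i → i ≤ ℓ → ∃ d, IsCombCube (C i) d) :
    (∑ k ∈ Finset.range (n + 1), Polynomial.C ((faceCount P k : ℚ)) * Polynomial.X ^ k
      = 1 + ∑ k ∈ Finset.Icc 1 n,
          Polynomial.C ((Nat.card {i : ℕ // i ∈ Finset.Icc 2 ℓ ∧ polyDim (C i) + 1 = k} : ℚ))
            * (1 + Polynomial.X * (Polynomial.X + 2) ^ (k - 1))) ∧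
    (∀ k, 1 ≤ k → k ≤ n →
      1 ≤ Nat.card {i : ℕ // i ∈ Finset.Icc 2 ℓ ∧ polyDim (C i) + 1 = k}) := by
  subst hn
  have hdim : ∀ i, 2 ≤ i → i ≤ ℓ → polyDim (C i) + 1 = polyDim (cs.E i) := fun i h2 hi =>
    (cs.finsum_interval hP hC hcube h2 hi).1
  constructor
  · have hfin : (faces P \ {∅}).Finite := hP.finite_faces.subset sdiff_subset
    have hsum := cs.finsum_cpx hP hC hcube cs.one_le le_rfl
    rw [cs.top, finsum_mem_eq_finite_toFinset_sum _ hfin,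
      sum_comp_eq_sum_card _ polyDim (Finset.range (polyDim P + 1)) (fun F hF => by
        rw [Finite.mem_toFinset] at hF
        exact Finset.mem_range.2 (Nat.lt_succ_of_le (hP.polyDim_mono (IsFaceOf.subset hF.1))))
        (fun k => X ^ k)] at hsum
    have hcount : ∀ k, faceCount P k =
        Nat.card {F : Set V // F ∈ hfin.toFinset ∧ polyDim F = k} := fun k =>
      Nat.card_congr (Equiv.subtypeEquivRight fun F => by
        rw [Finite.mem_toFinset, ← and_assoc, nonempty_iff_ne_empty]
        rfl)
    simp only [hcount]
    rw [hsum, ← sum_comp_eq_sum_card (Finset.Icc 2 ℓ) (fun i => polyDim (C i) + 1)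
      (Finset.Icc 1 (polyDim P)) (fun i hi => by
        rw [Finset.mem_Icc] at hi ⊢
        refine ⟨Nat.le_add_left _ _, ?_⟩
        rw [hdim i hi.1 hi.2]
        exact hP.polyDim_mono
          (cs.isFaceOf (by omega) hi.2 (cs.E_mem i hi.1 hi.2)).subset)
      (fun k => 1 + X * (X + 2) ^ (k - 1))]
    simp only [Nat.add_sub_cancel]
  · intro k hk hkn
    obtain ⟨i, h2, hi, hE⟩ := cs.exists_polyDim_E_eq hP hk hkn
    have : Finite {i : ℕ // i ∈ Finset.Icc 2 ℓ ∧ polyDim (C i) + 1 = k} :=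
      ((Finset.Icc 2 ℓ).finite_toSet.subset fun _ h => h.1).to_subtype
    have : Nonempty {i : ℕ // i ∈ Finset.Icc 2 ℓ ∧ polyDim (C i) + 1 = k} :=
      ⟨⟨i, Finset.mem_Icc.2 ⟨h2, hi⟩, by rw [hdim i h2 hi, hE]⟩⟩
    exact Nat.card_pos
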